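/- arXiv:0904.0316 — 6 statements merged into one kernel-verified Lean document; each statement's English description precedes it below -/
import Mathlib

section
/- Let (Ω, F, P) be a probability space. For each integer N ≥ 1 let a_N, b_N, c_N, d_N be real random variables with b_N ≠ 0 and d_N ≠ 0 almost surely, and let b be a real random variable. Assume there exist positive constants β, B₁, C₁, B₂, C₂, M such that: (I) |a_N/b_N − c_N/d_N| ≤ M almost surely for every N, and b ≥ β almost surely; (II) for all ε > 0 and all N ≥ 1, P(|b_N − b| > ε) ≤ B₁·exp(−C₁·N·ε²); (III) for all ε > 0 and all N ≥ 1, P(|a_N − (c_N/d_N)·b_N| > ε) ≤ B₂·exp(−C₂·N·(ε/M)²). Then for all ε > 0 and all N ≥ 1, P(|a_N/b_N − c_N/d_N| > ε) ≤ B₁·exp(−C₁·N·(εβ/(2M))²) + B₂·exp(−C₂·N·(εβ/(2M))²). -/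
open MeasureTheory

/-- If the quotient `x / y` is far from `r`, while `|x / y - r| ≤ M` and `β ≤ z`, then either
`y` is far from `z` or `x` is far from `r * y`. -/
theorem lt_abs_sub_or_lt_abs_sub_of_lt_abs_div_sub {x y z r β ε M : ℝ} (hβ : 0 < β)
    (hε : 0 < ε) (hM : 0 < M) (hy : y ≠ 0) (hR : |x / y - r| ≤ M) (hz : β ≤ z)
    (h : ε < |x / y - r|) :
    ε * β / (2 * M) < |y - z| ∨ ε * β / 2 < |x - r * y| := by
  by_contra! hcon
  obtain ⟨hyz, hxr⟩ := hcon
  have hsplit : (x / y - r) * z = (x - r * y) - (x / y - r) * (y - z) := by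
    field_simp
    ring
  have hupper : |x / y - r| * z ≤ ε * β / 2 + M * (ε * β / (2 * M)) :=
    calc |x / y - r| * z = |(x / y - r) * z| := by rw [abs_mul, abs_of_pos (hβ.trans_le hz)]
      _ ≤ |x - r * y| + |x / y - r| * |y - z| := by
        rw [hsplit, ← abs_mul]
        exact abs_sub _ _
      _ ≤ _ := by gcongr
  have hcancel : M * (ε * β / (2 * M)) = ε * β / 2 := by field_simp
  have hlower : ε * β < |x / y - r| * z := mul_lt_mul h hz hβ (abs_nonneg _)
  linarith

theorem stmt_0 {Ω : Type*} [MeasurableSpace Ω] (P : Measure Ω) [IsProbabilityMeasure P]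
    (a b c d : ℕ → Ω → ℝ) (blim : Ω → ℝ)
    (β B₁ C₁ B₂ C₂ M : ℝ)
    (hβ : 0 < β) (hB₁ : 0 < B₁) (hC₁ : 0 < C₁) (hB₂ : 0 < B₂) (hC₂ : 0 < C₂) (hM : 0 < M)
    (hne : ∀ N, 1 ≤ N → ∀ᵐ ω ∂P, b N ω ≠ 0 ∧ d N ω ≠ 0)
    (hI : ∀ N, 1 ≤ N → ∀ᵐ ω ∂P, |a N ω / b N ω - c N ω / d N ω| ≤ M)
    (hblim : ∀ᵐ ω ∂P, β ≤ blim ω)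
    (hII : ∀ ε : ℝ, 0 < ε → ∀ N, 1 ≤ N →
      P {ω | ε < |b N ω - blim ω|} ≤ ENNReal.ofReal (B₁ * Real.exp (-C₁ * N * ε ^ 2)))
    (hIII : ∀ ε : ℝ, 0 < ε → ∀ N, 1 ≤ N →
      P {ω | ε < |a N ω - (c N ω / d N ω) * b N ω|} ≤
        ENNReal.ofReal (B₂ * Real.exp (-C₂ * N * (ε / M) ^ 2))) :
    ∀ ε : ℝ, 0 < ε → ∀ N, 1 ≤ N →
      P {ω | ε < |a N ω / b N ω - c N ω / d N ω|} ≤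
        ENNReal.ofReal (B₁ * Real.exp (-C₁ * N * (ε * β / (2 * M)) ^ 2)
          + B₂ * Real.exp (-C₂ * N * (ε * β / (2 * M)) ^ 2)) := by
  intro ε hε N hN
  have hδ : 0 < ε * β / (2 * M) := by positivity
  have hη : 0 < ε * β / 2 := by positivity
  have hsub : ({ω | ε < |a N ω / b N ω - c N ω / d N ω|} : Set Ω) ≤ᵐ[P]
      ({ω | ε * β / (2 * M) < |b N ω - blim ω|} ∪
        {ω | ε * β / 2 < |a N ω - (c N ω / d N ω) * b N ω|} : Set Ω) := by
    filter_upwards [hne N hN, hI N hN, hblim] with ω hω hR hb hlt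
    exact lt_abs_sub_or_lt_abs_sub_of_lt_abs_div_sub hβ hε hM hω.1 hR hb hlt
  have hscale : ε * β / 2 / M = ε * β / (2 * M) := div_div _ _ _
  calc P {ω | ε < |a N ω / b N ω - c N ω / d N ω|}
      ≤ P ({ω | ε * β / (2 * M) < |b N ω - blim ω|} ∪
        {ω | ε * β / 2 < |a N ω - (c N ω / d N ω) * b N ω|}) := measure_mono_ae hsub
    _ ≤ _ := measure_union_le _ _
    _ ≤ _ := add_le_add (hII _ hδ N hN) (hIII _ hη N hN)
    _ = _ := by rw [hscale, ENNReal.ofReal_add (by positivity) (by positivity)]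
end

section
/- Let E be a normed vector space equipped with its Borel σ-algebra and let φ be a Borel probability measure on E. Let (μ_N)_{N≥1} be a sequence of random Borel probability measures on E, defined on a common probability space, such that for every bounded measurable f : E → ℝ, μ_N(f) → φ(f) in probability as N → ∞. Let (Υ_N)_{N≥1} be random measurable functions from E to ℝ and let υ : E → ℝ be a bounded measurable function such that: (i) there is a constant C < ∞ with sup_{x∈E} |Υ_N(x)| ≤ C almost surely for every N, and sup_{x∈E} |υ(x)| ≤ C; (ii) for every M ≥ 0, sup_{‖x‖≤M} |Υ_N(x) − υ(x)| → 0 in probability as N → ∞. Then μ_N(Υ_N) → φ(υ) in probability as N → ∞. -/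
open MeasureTheory Filter

/-- The mass that a finite measure gives to the complement of a large ball is small. -/
theorem exists_nat_integral_indicator_norm_gt_lt {E : Type*} [NormedAddCommGroup E]
    [MeasurableSpace E] [BorelSpace E] (φ : Measure E) [IsFiniteMeasure φ]
    {δ : ℝ} (hδ : 0 < δ) :
    ∃ n : ℕ, ∫ x, {x : E | (n : ℝ) < ‖x‖}.indicator (fun _ => (1 : ℝ)) x ∂φ < δ := by
  have hmeas (n : ℕ) : MeasurableSet {x : E | (n : ℝ) < ‖x‖} :=
    measurableSet_lt measurable_const measurable_norm
  have hlim : Tendsto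
      (fun n : ℕ => ∫ x, {x : E | (n : ℝ) < ‖x‖}.indicator (fun _ => (1 : ℝ)) x ∂φ)
      atTop (nhds (∫ _, (0 : ℝ) ∂φ)) := by
    refine tendsto_integral_of_dominated_convergence (fun _ => 1)
      (fun n => (measurable_const.indicator (hmeas n)).aestronglyMeasurable)
      (integrable_const _) (fun n => ae_of_all _ fun x => ?_) (ae_of_all _ fun x => ?_)
    · simpa using norm_indicator_le_norm_self (s := {x : E | (n : ℝ) < ‖x‖})
        (fun _ => (1 : ℝ)) x
    · refine tendsto_const_nhds.congr' ?_
      filter_upwards [eventually_ge_atTop ⌈‖x‖⌉₊] with n hn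
      exact (Set.indicator_of_notMem (by simpa using Nat.ceil_le.mp hn) _).symm
  rw [integral_zero] at hlim
  exact (hlim.eventually_lt_const hδ).exists

/-- Two functions bounded by `C` have integrals that differ by at most their uniform distance
on a ball plus `2 * C` times the mass of its complement. -/
theorem abs_integral_sub_integral_le {E : Type*} [NormedAddCommGroup E]
    [MeasurableSpace E] [BorelSpace E] (ν : Measure E) [IsProbabilityMeasure ν]
    {f g : E → ℝ} (hf : Measurable f) (hg : Measurable g) {C : ℝ}
    (hfC : ∀ x, |f x| ≤ C) (hgC : ∀ x, |g x| ≤ C) (M : ℝ) :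
    |(∫ x, f x ∂ν) - ∫ x, g x ∂ν| ≤ (⨆ x : {x : E // ‖x‖ ≤ M}, |f x - g x|) +
      2 * C * ∫ x, {x : E | M < ‖x‖}.indicator (fun _ => (1 : ℝ)) x ∂ν := by
  have hfi : Integrable f ν :=
    Integrable.of_bound hf.aestronglyMeasurable C (ae_of_all _ hfC)
  have hgi : Integrable g ν :=
    Integrable.of_bound hg.aestronglyMeasurable C (ae_of_all _ hgC)
  have hi : Integrable ({x : E | M < ‖x‖}.indicator (fun _ => (1 : ℝ))) ν :=
    (integrable_const _).indicator (measurableSet_lt measurable_const measurable_norm)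
  have hdiff (x : E) : |f x - g x| ≤ 2 * C := by
    linarith [abs_sub (f x) (g x), hfC x, hgC x]
  have hbdd : BddAbove (Set.range fun x : {x : E // ‖x‖ ≤ M} => |f x - g x|) :=
    ⟨2 * C, by rintro _ ⟨x, rfl⟩; exact hdiff x⟩
  have hsup : 0 ≤ ⨆ x : {x : E // ‖x‖ ≤ M}, |f x - g x| :=
    Real.iSup_nonneg fun _ => abs_nonneg _
  calc |(∫ x, f x ∂ν) - ∫ x, g x ∂ν| = |∫ x, (f x - g x) ∂ν| := by
        rw [integral_sub hfi hgi]
    _ ≤ ∫ x, |f x - g x| ∂ν := abs_integral_le_integral_abs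
    _ ≤ ∫ x, ((⨆ x : {x : E // ‖x‖ ≤ M}, |f x - g x|) +
          2 * C * {x : E | M < ‖x‖}.indicator (fun _ => (1 : ℝ)) x) ∂ν := by
        refine integral_mono (hfi.sub hgi).abs ((integrable_const _).add (hi.const_mul _))
          fun x => ?_
        by_cases hx : M < ‖x‖
        · simpa [hx] using (hdiff x).trans (le_add_of_nonneg_left hsup)
        · simpa [hx] using le_ciSup hbdd ⟨x, not_lt.mp hx⟩
    _ = _ := by
        rw [integral_add (integrable_const _) (hi.const_mul _), integral_const_mul]
        simp

theorem stmt_2 {E : Type*} [NormedAddCommGroup E] [NormedSpace ℝ E]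
    [MeasurableSpace E] [BorelSpace E]
    (φ : Measure E) [IsProbabilityMeasure φ]
    {Ω : Type*} [MeasurableSpace Ω] (P : Measure Ω) [IsProbabilityMeasure P]
    (μ : ℕ → Ω → Measure E) (hμ : ∀ N ω, IsProbabilityMeasure (μ N ω))
    (hμconv : ∀ f : E → ℝ, Measurable f → (∃ K, ∀ x, |f x| ≤ K) →
      ∀ ε : ℝ, 0 < ε →
        Tendsto (fun N => P {ω | ε ≤ |(∫ x, f x ∂(μ N ω)) - ∫ x, f x ∂φ|}) atTop (nhds 0))
    (Υ : ℕ → Ω → E → ℝ) (hΥmeas : ∀ N ω, Measurable (Υ N ω))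
    (υ : E → ℝ) (hυmeas : Measurable υ)
    (C : ℝ)
    (hΥbd : ∀ N, ∀ᵐ ω ∂P, ∀ x, |Υ N ω x| ≤ C)
    (hυbd : ∀ x, |υ x| ≤ C)
    (hloc : ∀ M : ℝ, 0 ≤ M → ∀ ε : ℝ, 0 < ε →
      Tendsto (fun N =>
        P {ω | ε ≤ ⨆ x : {x : E // ‖x‖ ≤ M}, |Υ N ω x - υ x|}) atTop (nhds 0)) :
    ∀ ε : ℝ, 0 < ε →
      Tendsto (fun N => P {ω | ε ≤ |(∫ x, Υ N ω x ∂(μ N ω)) - ∫ x, υ x ∂φ|})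
        atTop (nhds 0) := by
  intro ε hε
  have hC : 0 ≤ C := (abs_nonneg _).trans (hυbd 0)
  obtain ⟨δ, hδ, hCδ⟩ : ∃ δ : ℝ, 0 < δ ∧ 2 * C * (2 * δ) ≤ ε / 4 := by
    refine ⟨ε / (16 * (C + 1)), by positivity, ?_⟩
    rw [← sub_nonneg]
    have : ε / 4 - 2 * C * (2 * (ε / (16 * (C + 1)))) = ε / (4 * (C + 1)) := by
      field_simp
      ring
    rw [this]
    positivity
  obtain ⟨n, hn⟩ := exists_nat_integral_indicator_norm_gt_lt φ hδ
  set g : E → ℝ := {x : E | (n : ℝ) < ‖x‖}.indicator (fun _ => (1 : ℝ)) with hg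
  have hgmeas : Measurable g :=
    measurable_const.indicator (measurableSet_lt measurable_const measurable_norm)
  have hgbd : ∀ x, |g x| ≤ 1 := fun x => by
    simpa using norm_indicator_le_norm_self (s := {x : E | (n : ℝ) < ‖x‖})
      (fun _ => (1 : ℝ)) x
  have hsum := ((hloc n n.cast_nonneg (ε / 4) (by positivity)).add
    (hμconv g hgmeas ⟨1, hgbd⟩ δ hδ)).add (hμconv υ hυmeas ⟨C, hυbd⟩ (ε / 4) (by positivity))
  simp only [add_zero] at hsum
  refine tendsto_of_tendsto_of_tendsto_of_le_of_le tendsto_const_nhds hsum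
    (fun _ => zero_le) fun N => ?_
  refine le_trans (measure_mono_ae ?_)
    ((measure_union_le _ _).trans (add_le_add_left (measure_union_le _ _) _))
  filter_upwards [hΥbd N] with ω hω hfar
  by_contra hnot
  have hfar' : ε ≤ |(∫ x, Υ N ω x ∂(μ N ω)) - ∫ x, υ x ∂φ| := hfar
  obtain ⟨⟨hsup, htail⟩, hυ⟩ :
      ((⨆ x : {x : E // ‖x‖ ≤ n}, |Υ N ω x - υ x|) < ε / 4 ∧
        |(∫ x, g x ∂(μ N ω)) - ∫ x, g x ∂φ| < δ) ∧
        |(∫ x, υ x ∂(μ N ω)) - ∫ x, υ x ∂φ| < ε / 4 := by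
    refine ⟨⟨?_, ?_⟩, ?_⟩ <;> refine lt_of_not_ge fun h => hnot ?_
    exacts [Or.inl (Or.inl h), Or.inl (Or.inr h), Or.inr h]
  have := hμ N ω
  have hle := abs_integral_sub_integral_le (μ N ω) (hΥmeas N ω) hυmeas hω hυbd n
  rw [← hg] at hle
  have hmass : ∫ x, g x ∂(μ N ω) ≤ 2 * δ := by linarith [(abs_lt.mp htail).2]
  have hmul := mul_le_mul_of_nonneg_left hmass (by positivity : 0 ≤ 2 * C)
  have htri := abs_sub_le (∫ x, Υ N ω x ∂(μ N ω)) (∫ x, υ x ∂(μ N ω)) (∫ x, υ x ∂φ)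
  linarith
end

section
/- Let {Y_{n,i} : 1 ≤ i ≤ n, n ≥ 1} be a triangular array of real random variables, and suppose there exist constants B > 0, C > 0 and ρ with 0 < ρ < 1 such that for all n, all i ∈ {1, …, n} and all ε > 0, P(|Y_{n,i}| ≥ ε) ≤ B·exp(−C·ε²·ρ^{−2i}). Then there exist constants B̄ > 0 and C̄ > 0 such that for every n and every ε > 0, P(|Σ_{i=1}^n Y_{n,i}| ≥ ε) ≤ B̄·exp(−C̄·ε²). -/
open MeasureTheory

/-- Telescoped geometric sum starting at index one. -/
lemma one_sub_mul_sum_Icc_pow (r : ℝ) (n : ℕ) :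
    (1 - r) * ∑ i ∈ Finset.Icc 1 n, r ^ i = r - r ^ (n + 1) := by
  induction n with
  | zero => simp
  | succ n ih => rw [Finset.sum_Icc_succ_top (by omega), mul_add, ih]; ring

/-- Union bound for a sum: if the weights sum to less than one, a large sum forces some
term to exceed its weighted share of the threshold. -/
lemma measure_le_abs_sum_le {Ω ι : Type*} [MeasurableSpace Ω] (P : Measure Ω) (s : Finset ι)
    (X : ι → Ω → ℝ) (w : ι → ℝ) (hw : ∑ i ∈ s, w i < 1) {ε : ℝ} (hε : 0 < ε) :
    P {ω | ε ≤ |∑ i ∈ s, X i ω|} ≤ ∑ i ∈ s, P {ω | w i * ε ≤ |X i ω|} := by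
  refine (measure_mono fun ω hω => ?_).trans (measure_biUnion_finset_le s _)
  simp only [Set.mem_ofPred_eq, Set.mem_iUnion, exists_prop] at hω ⊢
  by_contra! h
  have h₁ : |∑ i ∈ s, X i ω| ≤ (∑ i ∈ s, w i) * ε := by
    rw [Finset.sum_mul]
    exact (Finset.abs_sum_le_sum_abs _ _).trans (Finset.sum_le_sum fun i hi => (h i hi).le)
  nlinarith

/-- Bernoulli's inequality turns the doubly exponential tail into a geometric one. -/
lemma exp_neg_div_pow_le {D ρ ε : ℝ} (hD : 0 < D) (hρ0 : 0 < ρ) (hρ1 : ρ < 1) (hε : 1 ≤ ε)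
    (i : ℕ) :
    Real.exp (-(D * ε ^ 2 / ρ ^ i)) ≤
      Real.exp (-D * ε ^ 2) * Real.exp (-(D * (ρ⁻¹ - 1))) ^ i := by
  rw [← Real.exp_nat_mul, ← Real.exp_add, Real.exp_le_exp]
  have hδ : 0 < ρ⁻¹ - 1 := sub_pos.2 ((one_lt_inv₀ hρ0).2 hρ1)
  have hbern : 1 + i * (ρ⁻¹ - 1) ≤ (ρ ^ i)⁻¹ := by
    have h := one_add_mul_le_pow (a := ρ⁻¹ - 1) (by linarith) i
    rwa [add_sub_cancel, inv_pow] at h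
  have hε2 : 1 ≤ ε ^ 2 := one_le_pow₀ hε
  have h₁ : D * ε ^ 2 * (1 + i * (ρ⁻¹ - 1)) ≤ D * ε ^ 2 / ρ ^ i := by
    rw [div_eq_mul_inv]; gcongr
  have h₂ : D * (i * (ρ⁻¹ - 1)) * 1 ≤ D * (i * (ρ⁻¹ - 1)) * ε ^ 2 := by gcongr
  linarith

theorem stmt_3 {Ω : Type*} [MeasurableSpace Ω] (P : Measure Ω) [IsProbabilityMeasure P]
    (Y : ℕ → ℕ → Ω → ℝ)
    (B C ρ : ℝ) (hB : 0 < B) (hC : 0 < C) (hρ0 : 0 < ρ) (hρ1 : ρ < 1)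
    (hY : ∀ n, ∀ i ∈ Finset.Icc 1 n, ∀ ε : ℝ, 0 < ε →
      P {ω | ε ≤ |Y n i ω|} ≤ ENNReal.ofReal (B * Real.exp (-C * ε ^ 2 / ρ ^ (2 * i)))) :
    ∃ B' C' : ℝ, 0 < B' ∧ 0 < C' ∧ ∀ n, ∀ ε : ℝ, 0 < ε →
      P {ω | ε ≤ |∑ i ∈ Finset.Icc 1 n, Y n i ω|} ≤
        ENNReal.ofReal (B' * Real.exp (-C' * ε ^ 2)) := by
  obtain ⟨r, hr0, rfl⟩ : ∃ r : ℝ, 0 < r ∧ r ^ 2 = ρ :=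
    ⟨√ρ, Real.sqrt_pos.2 hρ0, Real.sq_sqrt hρ0.le⟩
  have hr1 : r < 1 := by nlinarith
  have hr1' : 0 < 1 - r := sub_pos.2 hr1
  set D : ℝ := C * (1 - r) ^ 2 with hD_def
  have hD : 0 < D := by positivity
  set q : ℝ := Real.exp (-(D * ((r ^ 2)⁻¹ - 1))) with hq_def
  have hq0 : 0 < q := Real.exp_pos _
  have hq1 : q < 1 := by
    have hδ : 0 < (r ^ 2)⁻¹ - 1 := sub_pos.2 ((one_lt_inv₀ hρ0).2 hρ1)
    rw [hq_def, Real.exp_lt_one_iff]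
    exact neg_neg_of_pos (mul_pos hD hδ)
  have hq1' : 0 < 1 - q := sub_pos.2 hq1
  refine ⟨Real.exp D + B / (1 - q), D, by positivity, hD, fun n ε hε => ?_⟩
  rcases lt_or_ge ε 1 with hε1 | hε1
  · refine prob_le_one.trans (ENNReal.one_le_ofReal.2 ?_)
    have h₁ : 1 ≤ Real.exp D * Real.exp (-D * ε ^ 2) := by
      rw [← Real.exp_add, Real.one_le_exp_iff]
      nlinarith [pow_le_one₀ hε.le hε1.le (n := 2)]
    have h₂ : 0 ≤ B / (1 - q) * Real.exp (-D * ε ^ 2) := by positivity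
    linarith
  · have hw : ∑ i ∈ Finset.Icc 1 n, (1 - r) * r ^ i < 1 := by
      rw [← Finset.mul_sum, one_sub_mul_sum_Icc_pow]
      linarith [pow_pos hr0 (n + 1)]
    refine (measure_le_abs_sum_le P _ (Y n) _ hw hε).trans ?_
    refine (Finset.sum_le_sum fun i hi => hY n i hi _ (by positivity)).trans ?_
    rw [← ENNReal.ofReal_sum_of_nonneg fun i _ => by positivity]
    refine ENNReal.ofReal_le_ofReal ?_
    have hsum : ∑ i ∈ Finset.Icc 1 n, q ^ i ≤ 1 / (1 - q) := by
      rw [le_div_iff₀' hq1', one_sub_mul_sum_Icc_pow]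
      linarith [pow_pos hq0 (n + 1)]
    calc ∑ i ∈ Finset.Icc 1 n,
          B * Real.exp (-C * ((1 - r) * r ^ i * ε) ^ 2 / (r ^ 2) ^ (2 * i))
        ≤ ∑ i ∈ Finset.Icc 1 n, B * (Real.exp (-D * ε ^ 2) * q ^ i) := by
          refine Finset.sum_le_sum fun i _ => ?_
          have hexp : -C * ((1 - r) * r ^ i * ε) ^ 2 / (r ^ 2) ^ (2 * i) =
              -(D * ε ^ 2 / (r ^ 2) ^ i) := by
            rw [hD_def]; field_simp; ring
          rw [hexp]
          gcongr
          exact exp_neg_div_pow_le hD hρ0 hρ1 hε1 i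
      _ = B * Real.exp (-D * ε ^ 2) * ∑ i ∈ Finset.Icc 1 n, q ^ i := by
          rw [Finset.mul_sum]; exact Finset.sum_congr rfl fun i _ => by ring
      _ ≤ B * Real.exp (-D * ε ^ 2) * (1 / (1 - q)) := by gcongr
      _ = B / (1 - q) * Real.exp (-D * ε ^ 2) := by ring
      _ ≤ (Real.exp D + B / (1 - q)) * Real.exp (-D * ε ^ 2) := by
          gcongr; linarith [Real.exp_pos D]
end

section
/- For all integers s < t, all probability measures χ and χ' on X, and every bounded measurable function h : X → ℝ, if ∫∫ χ(dx_s) ℓ_{s,t}(x_s, x_t) ν(dx_t) > 0 and ∫∫ χ'(dx_s) ℓ_{s,t}(x_s, x_t) ν(dx_t) > 0, then | ∫∫ χ(dx_s) ℓ_{s,t}(x_s, x_t) h(x_t) ν(dx_t) / ∫∫ χ(dx_s) ℓ_{s,t}(x_s, x_t) ν(dx_t) − ∫∫ χ'(dx_s) ℓ_{s,t}(x_s, x_t) h(x_t) ν(dx_t) / ∫∫ χ'(dx_s) ℓ_{s,t}(x_s, x_t) ν(dx_t) | ≤ ρ^{t−s}·osc(h). -/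
open MeasureTheory

/-- `ell ν q g s n x y` is the kernel density `ℓ_{s, s+n+1}(x, y)`:
`ℓ_{s,s+1}(x,y) = q(x,y) g_{s+1}(y)` and
`ℓ_{s,t+1}(x,y) = ∫ ℓ_{s,t}(x,z) q(z,y) g_{t+1}(y) ν(dz)`. -/
noncomputable def ell {X : Type*} [MeasurableSpace X] (ν : Measure X)
    (q : X → X → ℝ) (g : ℕ → X → ℝ) (s : ℕ) : ℕ → X → X → ℝ
  | 0 => fun x y => q x y * g (s + 1) y
  | n + 1 => fun x y => ∫ z, ell ν q g s n x z * (q z y * g (s + n + 2) y) ∂ν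

/-- `ℓ_{s,t}` for `s < t`. -/
noncomputable def ellST {X : Type*} [MeasurableSpace X] (ν : Measure X)
    (q : X → X → ℝ) (g : ℕ → X → ℝ) (s t : ℕ) : X → X → ℝ :=
  ell ν q g s (t - s - 1)

/-- oscillation of a function -/
noncomputable def osc {X : Type*} (h : X → ℝ) : ℝ := ⨆ pr : X × X, |h pr.1 - h pr.2|

/-- A real function that is measurable and bounded. -/
def BddMeas {X : Type*} [MeasurableSpace X] (f : X → ℝ) : Prop :=
  Measurable f ∧ ∃ K, ∀ x, |f x| ≤ K

/-- The backward operator `f ↦ ∫ q(·, y) w(y) f(y) ν(dy)`. -/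
noncomputable def backwardOp {X : Type*} [MeasurableSpace X] (ν : Measure X)
    (q : X → X → ℝ) (w f : X → ℝ) : X → ℝ :=
  fun x => ∫ y, q x y * w y * f y ∂ν

namespace BddMeas

variable {X Y : Type*} [MeasurableSpace X] [MeasurableSpace Y]

lemma mul {f g : X → ℝ} (hf : BddMeas f) (hg : BddMeas g) : BddMeas fun x => f x * g x := by
  obtain ⟨hfm, K, hK⟩ := hf
  obtain ⟨hgm, L, hL⟩ := hg
  refine ⟨hfm.mul hgm, K * L, fun x => ?_⟩
  rw [abs_mul]
  exact mul_le_mul (hK x) (hL x) (abs_nonneg _) ((abs_nonneg _).trans (hK x))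

lemma comp {f : Y → ℝ} (hf : BddMeas f) {φ : X → Y} (hφ : Measurable φ) :
    BddMeas fun x => f (φ x) :=
  ⟨hf.1.comp hφ, hf.2.imp fun _ hK x => hK (φ x)⟩

lemma const (c : ℝ) : BddMeas fun _ : X => c :=
  ⟨measurable_const, |c|, fun _ => le_rfl⟩

lemma integrable {f : X → ℝ} (hf : BddMeas f) (μ : Measure X) [IsFiniteMeasure μ] :
    Integrable f μ := by
  obtain ⟨hfm, K, hK⟩ := hf
  exact Integrable.of_bound hfm.aestronglyMeasurable K (Filter.Eventually.of_forall hK)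

lemma integral {F : X × Y → ℝ} (hF : BddMeas F) (μ : Measure Y) [IsProbabilityMeasure μ] :
    BddMeas fun x => ∫ y, F (x, y) ∂μ := by
  obtain ⟨hFm, K, hK⟩ := hF
  refine ⟨(hFm.stronglyMeasurable.integral_prod_right' (ν := μ)).measurable, K, fun x => ?_⟩
  have := norm_integral_le_of_norm_le_const (μ := μ) (f := fun y => F (x, y)) (C := K)
    (Filter.Eventually.of_forall fun y => hK (x, y))
  simpa using this

lemma backwardOp {ν : Measure X} [IsProbabilityMeasure ν] {q : X → X → ℝ} {w f : X → ℝ}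
    (hq : BddMeas fun p : X × X => q p.1 p.2) (hw : BddMeas w) (hf : BddMeas f) :
    BddMeas (backwardOp ν q w f) :=
  ((hq.mul (hw.comp measurable_snd)).mul (hf.comp measurable_snd)).integral ν

lemma ell {ν : Measure X} [IsProbabilityMeasure ν] {q : X → X → ℝ} {g : ℕ → X → ℝ}
    (hq : BddMeas fun p : X × X => q p.1 p.2) (hg : ∀ u, BddMeas (g u)) (s n : ℕ) :
    BddMeas fun p : X × X => ell ν q g s n p.1 p.2 := by
  induction n with
  | zero => exact hq.mul ((hg (s + 1)).comp measurable_snd)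
  | succ n ih =>
    have hF : BddMeas fun p : (X × X) × X =>
        _root_.ell ν q g s n p.1.1 p.2 * (q p.2 p.1.2 * g (s + n + 2) p.1.2) :=
      (ih.comp (φ := fun p : (X × X) × X => (p.1.1, p.2)) (by fun_prop)).mul
        ((hq.comp (φ := fun p : (X × X) × X => (p.2, p.1.2)) (by fun_prop)).mul
          ((hg (s + n + 2)).comp (φ := fun p : (X × X) × X => p.1.2) (by fun_prop)))
    exact hF.integral ν

end BddMeas

lemma integral_ell_succ_mul {X : Type*} [MeasurableSpace X] {ν : Measure X}
    [IsProbabilityMeasure ν] {q : X → X → ℝ} {g : ℕ → X → ℝ}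
    (hq : BddMeas fun p : X × X => q p.1 p.2) (hg : ∀ u, BddMeas (g u)) (s n : ℕ)
    {f : X → ℝ} (hf : BddMeas f) (x : X) :
    ∫ y, ell ν q g s (n + 1) x y * f y ∂ν =
      ∫ z, ell ν q g s n x z * backwardOp ν q (g (s + n + 2)) f z ∂ν := by
  have hF : BddMeas fun p : X × X =>
      ell ν q g s n x p.2 * (q p.2 p.1 * g (s + n + 2) p.1) * f p.1 :=
    (((BddMeas.ell hq hg s n).comp (φ := fun p : X × X => (x, p.2)) (by fun_prop)).mul
      ((hq.comp measurable_swap).mul ((hg (s + n + 2)).comp measurable_fst))).mul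
      (hf.comp measurable_fst)
  calc ∫ y, ell ν q g s (n + 1) x y * f y ∂ν
      = ∫ y, ∫ z, ell ν q g s n x z * (q z y * g (s + n + 2) y) * f y ∂ν ∂ν :=
        integral_congr_ae (Filter.Eventually.of_forall fun y => (integral_mul_const _ _).symm)
    _ = ∫ z, ∫ y, ell ν q g s n x z * (q z y * g (s + n + 2) y) * f y ∂ν ∂ν :=
        integral_integral_swap (hF.integrable (ν.prod ν))
    _ = ∫ z, ell ν q g s n x z * backwardOp ν q (g (s + n + 2)) f z ∂ν := by
        refine integral_congr_ae (Filter.Eventually.of_forall fun z => ?_)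
        simp only [backwardOp, ← integral_const_mul, mul_assoc]

/-- If `α D ≤ N ≤ (α + c) D`, then one application of the backward operator shrinks the width of
the enclosing interval by the Doeblin factor `1 - σm / σp`. -/
lemma exists_backwardOp_enclosure {X : Type*} [MeasurableSpace X] {ν : Measure X}
    [IsProbabilityMeasure ν] {σm σp : ℝ} (hσm : 0 < σm) (hσmp : σm ≤ σp)
    {q : X → X → ℝ} (hqb : BddMeas fun p : X × X => q p.1 p.2)
    (hq : ∀ x y, σm ≤ q x y ∧ q x y ≤ σp)
    {w : X → ℝ} (hw : BddMeas w) (hw0 : ∀ x, 0 ≤ w x)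
    {N D : X → ℝ} (hN : BddMeas N) (hD : BddMeas D) (hD0 : ∀ x, 0 ≤ D x) {α c : ℝ}
    (hND : ∀ x, α * D x ≤ N x ∧ N x ≤ (α + c) * D x) :
    ∃ α', ∀ x, α' * backwardOp ν q w D x ≤ backwardOp ν q w N x ∧
      backwardOp ν q w N x ≤ (α' + (1 - σm / σp) * c) * backwardOp ν q w D x := by
  have hσp : 0 < σp := hσm.trans_le hσmp
  set L := ∫ y, w y * D y ∂ν with hL
  set P := ∫ y, w y * N y ∂ν with hP
  refine ⟨σm / σp * P / L + (1 - σm / σp) * α, fun x => ?_⟩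
  have hqx : BddMeas (q x) := hqb.comp (φ := fun y => (x, y)) (by fun_prop)
  have hwD := hw.mul hD
  have hwN := hw.mul hN
  have hqwD := (hqx.mul hw).mul hD
  have hqwN := (hqx.mul hw).mul hN
  have hL0 : 0 ≤ L := integral_nonneg fun y => mul_nonneg (hw0 y) (hD0 y)
  have hB0 : 0 ≤ backwardOp ν q w D x := integral_nonneg fun y =>
    mul_nonneg (mul_nonneg (hσm.le.trans (hq x y).1) (hw0 y)) (hD0 y)
  have hBL : backwardOp ν q w D x ≤ σp * L := by
    rw [hL, ← integral_const_mul]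
    refine integral_mono (hqwD.integrable ν) ((hwD.integrable ν).const_mul _) fun y => ?_
    simp only [mul_assoc]
    exact mul_le_mul_of_nonneg_right (hq x y).2 (mul_nonneg (hw0 y) (hD0 y))
  set B := backwardOp ν q w D x with hB
  set κ := σm / σp * (B / L) with hκ
  have hκσ : κ ≤ σm := by
    have : B / L ≤ σp := div_le_of_le_mul₀ hL0 hσp.le hBL
    calc κ ≤ σm / σp * σp := mul_le_mul_of_nonneg_left this (by positivity)
      _ = σm := by field_simp
  have hκL : κ * L = σm / σp * B := by
    rcases hL0.eq_or_lt with h0 | h0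
    · have : B = 0 := le_antisymm (by simpa [← h0] using hBL) hB0
      simp [hκ, this]
    · rw [hκ]; field_simp
  have hresidual (f : X → ℝ) (hf : BddMeas f) :
      Integrable (fun y => (q x y - κ) * w y * f y) ν ∧
      ∫ y, (q x y - κ) * w y * f y ∂ν = backwardOp ν q w f x - κ * ∫ y, w y * f y ∂ν := by
    have hi := ((hqx.mul hw).mul hf).integrable ν
    have hi' := ((hw.mul hf).integrable ν).const_mul κ
    have hfun : (fun y => (q x y - κ) * w y * f y) =
        fun y => q x y * w y * f y - κ * (w y * f y) := by
      funext y; ring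
    rw [hfun]
    exact ⟨hi.sub hi', by rw [integral_sub hi hi', integral_const_mul]; rfl⟩
  obtain ⟨hiN, heN⟩ := hresidual N hN
  obtain ⟨hiD, heD⟩ := hresidual D hD
  have hr (y : X) : 0 ≤ (q x y - κ) * w y :=
    mul_nonneg (by linarith [(hq x y).1]) (hw0 y)
  have hlo := integral_mono (hiD.const_mul α) hiN fun y => by
    have := mul_le_mul_of_nonneg_left (hND y).1 (hr y)
    simp only
    linarith
  have hhi := integral_mono hiN (hiD.const_mul (α + c)) fun y => by
    have := mul_le_mul_of_nonneg_left (hND y).2 (hr y)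
    simp only
    linarith
  rw [integral_const_mul, heN, heD, ← hL, ← hP, ← hB, hκL] at hlo hhi
  have hκP : σm / σp * P / L * B = κ * P := by rw [hκ]; ring
  constructor <;> linarith

/-- Iterating `exists_backwardOp_enclosure` along the kernel `ell`. -/
lemma exists_integral_ell_enclosure {X : Type*} [MeasurableSpace X] {ν : Measure X}
    [IsProbabilityMeasure ν] {σm σp : ℝ} (hσm : 0 < σm) (hσmp : σm ≤ σp)
    {q : X → X → ℝ} (hqb : BddMeas fun p : X × X => q p.1 p.2)
    (hq : ∀ x y, σm ≤ q x y ∧ q x y ≤ σp)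
    {g : ℕ → X → ℝ} (hg : ∀ u, BddMeas (g u)) (hg0 : ∀ u x, 0 ≤ g u x) (s n : ℕ)
    {N D : X → ℝ} (hN : BddMeas N) (hD : BddMeas D) (hD0 : ∀ x, 0 ≤ D x) {α c : ℝ}
    (hND : ∀ x, α * D x ≤ N x ∧ N x ≤ (α + c) * D x) :
    ∃ α', ∀ x, α' * ∫ y, ell ν q g s n x y * D y ∂ν ≤ ∫ y, ell ν q g s n x y * N y ∂ν ∧
      ∫ y, ell ν q g s n x y * N y ∂ν ≤
        (α' + (1 - σm / σp) ^ (n + 1) * c) * ∫ y, ell ν q g s n x y * D y ∂ν := by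
  induction n generalizing N D α c with
  | zero =>
    simpa [backwardOp, ell] using
      exists_backwardOp_enclosure (ν := ν) hσm hσmp hqb hq (hg (s + 1)) (hg0 _) hN hD hD0 hND
  | succ n ih =>
    obtain ⟨α₁, h₁⟩ := exists_backwardOp_enclosure (ν := ν) hσm hσmp hqb hq (hg (s + n + 2))
      (hg0 _) hN hD hD0 hND
    have hBD0 (x : X) : 0 ≤ backwardOp ν q (g (s + n + 2)) D x := integral_nonneg fun y =>
      mul_nonneg (mul_nonneg (hσm.le.trans (hq x y).1) (hg0 _ y)) (hD0 y)
    obtain ⟨α₂, h₂⟩ := ih (.backwardOp hqb (hg _) hN) (.backwardOp hqb (hg _) hD) hBD0 h₁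
    refine ⟨α₂, fun x => ?_⟩
    rw [integral_ell_succ_mul hqb hg s n hN, integral_ell_succ_mul hqb hg s n hD, pow_succ,
      mul_assoc]
    exact h₂ x

lemma exists_osc_enclosure {X : Type*} [Nonempty X] {h : X → ℝ} (hb : ∃ K, ∀ x, |h x| ≤ K) :
    ∃ α, ∀ x, α ≤ h x ∧ h x ≤ α + osc h := by
  obtain ⟨K, hK⟩ := hb
  have hbelow : BddBelow (Set.range h) := ⟨-K, by
    rintro _ ⟨x, rfl⟩; exact (abs_le.mp (hK x)).1⟩
  have habove : BddAbove (Set.range fun p : X × X => |h p.1 - h p.2|) := ⟨K + K, by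
    rintro _ ⟨p, rfl⟩
    exact (abs_sub _ _).trans (add_le_add (hK _) (hK _))⟩
  refine ⟨⨅ x, h x, fun x => ⟨ciInf_le hbelow x, ?_⟩⟩
  have : h x - osc h ≤ ⨅ y, h y := le_ciInf fun y => by
    have h₁ : |h x - h y| ≤ osc h := le_ciSup habove (x, y)
    linarith [le_abs_self (h x - h y)]
  linarith

theorem stmt_4 {X : Type*} [MeasurableSpace X] (ν : Measure X) (hν : ν Set.univ = 1)
    (σm σp : ℝ) (hσm : 0 < σm) (hσmp : σm ≤ σp)
    (q : X → X → ℝ) (hqmeas : Measurable fun pr : X × X => q pr.1 pr.2)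
    (hq : ∀ x y, σm ≤ q x y ∧ q x y ≤ σp)
    (g : ℕ → X → ℝ) (hgmeas : ∀ u, Measurable (g u))
    (hg0 : ∀ u x, 0 ≤ g u x) (hgb : ∀ u, ∃ K, ∀ x, g u x ≤ K)
    (s t : ℕ) (hst : s < t)
    (χ χ' : Measure X) [IsProbabilityMeasure χ] [IsProbabilityMeasure χ']
    (h : X → ℝ) (hhm : Measurable h) (hhb : ∃ K, ∀ x, |h x| ≤ K)
    (hpos : 0 < ∫ x, ∫ y, ellST ν q g s t x y ∂ν ∂χ)
    (hpos' : 0 < ∫ x, ∫ y, ellST ν q g s t x y ∂ν ∂χ') :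
    |(∫ x, ∫ y, ellST ν q g s t x y * h y ∂ν ∂χ) /
        (∫ x, ∫ y, ellST ν q g s t x y ∂ν ∂χ) -
      (∫ x, ∫ y, ellST ν q g s t x y * h y ∂ν ∂χ') /
        (∫ x, ∫ y, ellST ν q g s t x y ∂ν ∂χ')| ≤
      (1 - σm / σp) ^ (t - s) * osc h := by
  have : IsProbabilityMeasure ν := ⟨hν⟩
  have : Nonempty X := χ.nonempty_of_neZero
  have hqb : BddMeas fun p : X × X => q p.1 p.2 := ⟨hqmeas, σp, fun p =>
    abs_le.mpr ⟨by linarith [(hq p.1 p.2).1], (hq p.1 p.2).2⟩⟩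
  have hg (u : ℕ) : BddMeas (g u) := ⟨hgmeas u, (hgb u).imp fun K hK x => by
    rw [abs_of_nonneg (hg0 u x)]; exact hK x⟩
  have hh : BddMeas h := ⟨hhm, hhb⟩
  obtain ⟨α, hα⟩ := exists_osc_enclosure hhb
  obtain ⟨β, hβ⟩ := exists_integral_ell_enclosure (ν := ν) hσm hσmp hqb hq hg hg0 s (t - s - 1)
    hh (.const 1) (fun _ => zero_le_one) (α := α) (c := osc h) (by simpa using hα)
  have hts : t - s - 1 + 1 = t - s := by omega
  simp only [mul_one, hts] at hβ
  have hell : BddMeas fun p : X × X => ellST ν q g s t p.1 p.2 := .ell hqb hg s _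
  have hmean (μ : Measure X) [IsProbabilityMeasure μ]
      (hμ : 0 < ∫ x, ∫ y, ellST ν q g s t x y ∂ν ∂μ) :
      β ≤ (∫ x, ∫ y, ellST ν q g s t x y * h y ∂ν ∂μ) / (∫ x, ∫ y, ellST ν q g s t x y ∂ν ∂μ) ∧
      (∫ x, ∫ y, ellST ν q g s t x y * h y ∂ν ∂μ) / (∫ x, ∫ y, ellST ν q g s t x y ∂ν ∂μ) ≤
        β + (1 - σm / σp) ^ (t - s) * osc h := by
    have hiD := (hell.integral ν).integrable μ
    have hiN := ((hell.mul (hh.comp measurable_snd)).integral ν).integrable μ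
    rw [le_div_iff₀ hμ, div_le_iff₀ hμ, ← integral_const_mul, ← integral_const_mul]
    exact ⟨integral_mono (hiD.const_mul _) hiN fun x => (hβ x).1,
      integral_mono hiN (hiD.const_mul _) fun x => (hβ x).2⟩
  have h₁ := hmean χ hpos
  have h₂ := hmean χ' hpos'
  rw [abs_le]
  constructor <;> linarith [h₁.1, h₁.2, h₂.1, h₂.2]
end

section
/- For all integers s < t, every probability measure χ on X, every bounded measurable function h : X → ℝ, and all bounded nonnegative measurable functions f, f' : X → ℝ such that ∫∫ χ(dx_s) ℓ_{s,t}(x_s, x_t) f(x_t) ν(dx_t) > 0 and ∫∫ χ(dx_s) ℓ_{s,t}(x_s, x_t) f'(x_t) ν(dx_t) > 0, one has | ∫∫ χ(dx_s) h(x_s) ℓ_{s,t}(x_s, x_t) f(x_t) ν(dx_t) / ∫∫ χ(dx_s) ℓ_{s,t}(x_s, x_t) f(x_t) ν(dx_t) − ∫∫ χ(dx_s) h(x_s) ℓ_{s,t}(x_s, x_t) f'(x_t) ν(dx_t) / ∫∫ χ(dx_s) ℓ_{s,t}(x_s, x_t) f'(x_t) ν(dx_t) | ≤ ρ^{t−s}·osc(h).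 -/
open MeasureTheory

/-- One mixing step: bounds `a * m ≤ M ≤ (a + δ) * m` on densities improve, after integration
against any weight with values in `[σm, σp]`, to bounds whose gap is `(1 - σm / σp) * δ`,
uniformly in the weight. -/
theorem exists_bounds_integral_mul {X : Type*} [MeasurableSpace X] {μ : Measure X}
    {σm σp : ℝ} (hσm : 0 < σm) (hσmp : σm ≤ σp) {m M : X → ℝ}
    (hm : Integrable m μ) (hM : Integrable M μ) (hm0 : ∀ x, 0 ≤ m x) {a δ : ℝ}
    (hlow : ∀ x, a * m x ≤ M x) (hup : ∀ x, M x ≤ (a + δ) * m x) :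
    ∃ b, ∀ w : X → ℝ, Measurable w → (∀ x, σm ≤ w x ∧ w x ≤ σp) →
      b * ∫ x, m x * w x ∂μ ≤ ∫ x, M x * w x ∂μ ∧
      ∫ x, M x * w x ∂μ ≤ (b + (1 - σm / σp) * δ) * ∫ x, m x * w x ∂μ := by
  have hσp : 0 < σp := hσm.trans_le hσmp
  set I := ∫ x, m x ∂μ with hI
  set J := ∫ x, M x ∂μ with hJ
  have hI0 : 0 ≤ I := integral_nonneg hm0
  have hJlow : a * I ≤ J := by
    rw [hI, hJ, ← integral_const_mul]
    exact integral_mono (hm.const_mul a) hM hlow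
  have hJup : J ≤ (a + δ) * I := by
    rw [hI, hJ, ← integral_const_mul]
    exact integral_mono hM (hm.const_mul _) hup
  obtain ⟨θ, hθ0, hθδ, hθ⟩ : ∃ θ, (0 ≤ θ * I) ∧ (0 ≤ (δ - θ) * I) ∧ J - a * I = θ * I := by
    refine ⟨(J - a * I) / I, ?_⟩
    have key : J - a * I = (J - a * I) / I * I := by
      rcases hI0.eq_or_lt with h0 | h0
      · rw [← h0] at hJlow hJup ⊢
        simp only [mul_zero] at hJlow hJup ⊢
        linarith
      · field_simp
    refine ⟨?_, ?_, key⟩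
    · rw [← key]; linarith
    · rw [sub_mul, ← key]; linarith
  refine ⟨a + σm / σp * θ, fun w hwm hw => ?_⟩
  have hwb : ∀ᵐ x ∂μ, ‖w x‖ ≤ σp := ae_of_all _ fun x => by
    rw [Real.norm_eq_abs, abs_of_nonneg (hσm.le.trans (hw x).1)]
    exact (hw x).2
  have hmw : Integrable (fun x => m x * w x) μ := hm.mul_bdd hwm.aestronglyMeasurable hwb
  have hMw : Integrable (fun x => M x * w x) μ := hM.mul_bdd hwm.aestronglyMeasurable hwb
  set P := ∫ x, m x * w x ∂μ with hP
  set Q := ∫ x, M x * w x ∂μ with hQ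
  have hP0 : 0 ≤ P := integral_nonneg fun x => mul_nonneg (hm0 x) (hσm.le.trans (hw x).1)
  have hPup : P ≤ σp * I := by
    rw [hP, hI, ← integral_const_mul]
    refine integral_mono hmw (hm.const_mul _) fun x => ?_
    have := mul_le_mul_of_nonneg_left (hw x).2 (hm0 x)
    simp only
    linarith
  have hlow' : σm * (J - a * I) ≤ Q - a * P := by
    rw [hP, hQ, hI, hJ, ← integral_const_mul a, ← integral_const_mul a, ← integral_sub hM
      (hm.const_mul a), ← integral_sub hMw (hmw.const_mul a), ← integral_const_mul]
    refine integral_mono ((hM.sub (hm.const_mul a)).const_mul _)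
      (hMw.sub (hmw.const_mul a)) fun x => ?_
    have := mul_le_mul_of_nonneg_right (hw x).1 (sub_nonneg.2 (hlow x))
    simp only
    linarith
  have hup' : σm * ((a + δ) * I - J) ≤ (a + δ) * P - Q := by
    rw [hP, hQ, hI, hJ, ← integral_const_mul (a + δ), ← integral_const_mul (a + δ),
      ← integral_sub (hm.const_mul _) hM, ← integral_sub (hmw.const_mul _) hMw,
      ← integral_const_mul]
    refine integral_mono (((hm.const_mul _).sub hM).const_mul _)
      ((hmw.const_mul _).sub hMw) fun x => ?_
    have := mul_le_mul_of_nonneg_right (hw x).1 (sub_nonneg.2 (hup x))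
    simp only
    linarith
  have scale : ∀ c : ℝ, 0 ≤ c * I → σm / σp * c * P ≤ σm * (c * I) := by
    intro c hc
    rcases le_or_gt 0 c with h0 | h0
    · calc σm / σp * c * P ≤ σm / σp * c * (σp * I) := by gcongr
        _ = σm * (c * I) := by field_simp
    · have : σm / σp * c * P ≤ 0 :=
        mul_nonpos_of_nonpos_of_nonneg
          (mul_nonpos_of_nonneg_of_nonpos (by positivity) h0.le) hP0
      exact this.trans (by positivity)
  have h1 := scale θ hθ0
  have h2 := scale (δ - θ) hθδ
  rw [hθ] at hlow'
  have h3 : (a + δ) * I - J = (δ - θ) * I := by linear_combination -hθ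
  rw [h3] at hup'
  constructor
  · linarith
  · linarith

/-- Fubini for bounded integrands, in the form used to move a test function through a kernel. -/
theorem integral_mul_integral_mul_comm {X Y : Type*} [MeasurableSpace X] [MeasurableSpace Y]
    {μ : Measure X} {ν : Measure Y} [IsFiniteMeasure μ] [IsFiniteMeasure ν]
    {h : X → ℝ} {k : X → Y → ℝ} {φ : Y → ℝ}
    (hh : Measurable h) (hk : Measurable fun p : X × Y => k p.1 p.2) (hφ : Measurable φ)
    (hhb : ∃ K, ∀ x, |h x| ≤ K) (hkb : ∃ K, ∀ x y, |k x y| ≤ K) (hφb : ∃ K, ∀ y, |φ y| ≤ K) :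
    ∫ x, h x * ∫ y, k x y * φ y ∂ν ∂μ = ∫ y, (∫ x, h x * k x y ∂μ) * φ y ∂ν := by
  obtain ⟨A, hA⟩ := hhb
  obtain ⟨B, hB⟩ := hkb
  obtain ⟨C, hC⟩ := hφb
  simp_rw [← integral_const_mul, ← integral_mul_const]
  rw [integral_integral_swap]
  · simp_rw [mul_assoc]
  · have hmeas : Measurable fun p : X × Y => h p.1 * (k p.1 p.2 * φ p.2) :=
      (hh.comp measurable_fst).mul (hk.mul (hφ.comp measurable_snd))
    refine Integrable.of_bound hmeas.aestronglyMeasurable (A * (B * C)) (ae_of_all _ fun p => ?_)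
    simp only [Function.uncurry, Real.norm_eq_abs, abs_mul]
    have hA0 := (abs_nonneg _).trans (hA p.1)
    have hB0 := (abs_nonneg _).trans (hB p.1 p.2)
    exact mul_le_mul (hA _) (mul_le_mul (hB _ _) (hC _) (abs_nonneg _) hB0)
      (by positivity) hA0

theorem ell_measurable {X : Type*} [MeasurableSpace X] {ν : Measure X} [SFinite ν]
    {q : X → X → ℝ} (hq : Measurable fun p : X × X => q p.1 p.2)
    {g : ℕ → X → ℝ} (hg : ∀ u, Measurable (g u)) (s n : ℕ) :
    Measurable fun p : X × X => ell ν q g s n p.1 p.2 := by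
  induction n with
  | zero => exact hq.mul ((hg _).comp measurable_snd)
  | succ n ih =>
    have h1 : Measurable fun r : (X × X) × X => ell ν q g s n r.1.1 r.2 :=
      ih.comp ((measurable_fst.comp measurable_fst).prodMk measurable_snd)
    have h2 : Measurable fun r : (X × X) × X => q r.2 r.1.2 :=
      hq.comp (measurable_snd.prodMk (measurable_snd.comp measurable_fst))
    have h3 : Measurable fun r : (X × X) × X => g (s + n + 2) r.1.2 :=
      (hg _).comp (measurable_snd.comp measurable_fst)
    exact (h1.mul (h2.mul h3)).stronglyMeasurable.integral_prod_right'.measurable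

theorem ell_nonneg {X : Type*} [MeasurableSpace X] {ν : Measure X} {q : X → X → ℝ}
    (hq : ∀ x y, 0 ≤ q x y) {g : ℕ → X → ℝ} (hg : ∀ u x, 0 ≤ g u x) (s n : ℕ) (x y : X) :
    0 ≤ ell ν q g s n x y := by
  induction n generalizing y with
  | zero => exact mul_nonneg (hq _ _) (hg _ _)
  | succ n ih => exact integral_nonneg fun z => mul_nonneg (ih z) (mul_nonneg (hq _ _) (hg _ _))

theorem ell_bounded {X : Type*} [MeasurableSpace X] {ν : Measure X} [IsFiniteMeasure ν]
    {q : X → X → ℝ} (hq : ∃ K, ∀ x y, |q x y| ≤ K)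
    {g : ℕ → X → ℝ} (hg : ∀ u, ∃ K, ∀ x, |g u x| ≤ K) (s n : ℕ) :
    ∃ K, ∀ x y, |ell ν q g s n x y| ≤ K := by
  obtain ⟨A, hA⟩ := hq
  induction n with
  | zero =>
    obtain ⟨B, hB⟩ := hg (s + 1)
    refine ⟨A * B, fun x y => ?_⟩
    rw [ell, abs_mul]
    exact mul_le_mul (hA _ _) (hB _) (abs_nonneg _) ((abs_nonneg _).trans (hA x y))
  | succ n ih =>
    obtain ⟨B, hB⟩ := hg (s + n + 2)
    obtain ⟨C, hC⟩ := ih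
    refine ⟨C * (A * B) * ν.real Set.univ, fun x y => ?_⟩
    rw [ell, ← Real.norm_eq_abs]
    refine norm_integral_le_of_norm_le_const (ae_of_all _ fun z => ?_)
    rw [Real.norm_eq_abs, abs_mul, abs_mul]
    have hA0 := (abs_nonneg _).trans (hA z y)
    have hC0 := (abs_nonneg _).trans (hC x z)
    exact mul_le_mul (hC _ _) (mul_le_mul (hA _ _) (hB _) (abs_nonneg _) hA0)
      (by positivity) hC0

theorem integrable_integral_mul_kernel {X Y : Type*} [MeasurableSpace X] [MeasurableSpace Y]
    {μ : Measure X} {ν : Measure Y} [IsFiniteMeasure μ] [IsFiniteMeasure ν]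
    {h : X → ℝ} {k : X → Y → ℝ} (hh : Measurable h) (hk : Measurable fun p : X × Y => k p.1 p.2)
    (hhb : ∃ K, ∀ x, |h x| ≤ K) (hkb : ∃ K, ∀ x y, |k x y| ≤ K) :
    Integrable (fun y => ∫ x, h x * k x y ∂μ) ν := by
  obtain ⟨A, hA⟩ := hhb
  obtain ⟨B, hB⟩ := hkb
  have hmeas : Measurable fun p : X × Y => h p.1 * k p.1 p.2 := (hh.comp measurable_fst).mul hk
  refine Integrable.of_bound
    hmeas.stronglyMeasurable.integral_prod_left'.measurable.aestronglyMeasurable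
    (A * B * μ.real Set.univ) (ae_of_all _ fun y => ?_)
  refine norm_integral_le_of_norm_le_const (ae_of_all _ fun x => ?_)
  rw [Real.norm_eq_abs, abs_mul]
  exact mul_le_mul (hA _) (hB _ _) (abs_nonneg _) ((abs_nonneg _).trans (hA x))

/-- A bounded function takes its values in an interval of length `osc h`. -/
theorem exists_bounds_osc {X : Type*} [Nonempty X] {h : X → ℝ} (hb : ∃ K, ∀ x, |h x| ≤ K) :
    ∃ a, ∀ x, a ≤ h x ∧ h x ≤ a + osc h := by
  obtain ⟨K, hK⟩ := hb
  have hbdd : BddAbove (Set.range fun p : X × X => |h p.1 - h p.2|) := by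
    refine ⟨K + K, ?_⟩
    rintro _ ⟨p, rfl⟩
    exact (abs_sub _ _).trans (add_le_add (hK _) (hK _))
  have hbelow : BddBelow (Set.range h) := by
    refine ⟨-K, ?_⟩
    rintro _ ⟨x, rfl⟩
    exact (abs_le.1 (hK x)).1
  refine ⟨⨅ x, h x, fun x => ⟨ciInf_le hbelow x, ?_⟩⟩
  have : h x - osc h ≤ ⨅ y, h y := le_ciInf fun y => by
    have h1 : |h x - h y| ≤ osc h := le_ciSup hbdd (x, y)
    linarith [le_abs_self (h x - h y)]
  linarith

/-- Uniform bounds on the backward densities: `∫ h(x) ℓ(x, y) χ(dx)` lies between two multiples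
of `∫ ℓ(x, y) χ(dx)` whose gap decays geometrically in the number of steps. -/
theorem exists_bounds_integral_mul_ell {X : Type*} [MeasurableSpace X] {ν : Measure X}
    [IsFiniteMeasure ν] {σm σp : ℝ} (hσm : 0 < σm) (hσmp : σm ≤ σp)
    {q : X → X → ℝ} (hqm : Measurable fun p : X × X => q p.1 p.2)
    (hq : ∀ x y, σm ≤ q x y ∧ q x y ≤ σp)
    {g : ℕ → X → ℝ} (hgm : ∀ u, Measurable (g u)) (hg0 : ∀ u x, 0 ≤ g u x)
    (hgb : ∀ u, ∃ K, ∀ x, |g u x| ≤ K) (s n : ℕ)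
    {χ : Measure X} [IsFiniteMeasure χ] [Nonempty X]
    {h : X → ℝ} (hhm : Measurable h) (hhb : ∃ K, ∀ x, |h x| ≤ K) :
    ∃ a, ∀ y, a * ∫ x, 1 * ell ν q g s n x y ∂χ ≤ ∫ x, h x * ell ν q g s n x y ∂χ ∧
      ∫ x, h x * ell ν q g s n x y ∂χ ≤
        (a + (1 - σm / σp) ^ (n + 1) * osc h) * ∫ x, 1 * ell ν q g s n x y ∂χ := by
  have hq0 : ∀ x y, 0 ≤ q x y := fun x y => hσm.le.trans (hq x y).1
  have hqb : ∃ K, ∀ x y, |q x y| ≤ K :=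
    ⟨σp, fun x y => by rw [abs_of_nonneg (hq0 x y)]; exact (hq x y).2⟩
  have hqy : ∀ y, Measurable fun x => q x y := fun y => hqm.comp measurable_prodMk_right
  have h1b : ∃ K : ℝ, ∀ _ : X, |(1 : ℝ)| ≤ K := ⟨1, fun _ => by simp⟩
  induction n with
  | zero =>
    obtain ⟨a, ha⟩ := exists_bounds_osc hhb
    obtain ⟨K, hK⟩ := hhb
    have hhi : Integrable h χ := Integrable.of_bound hhm.aestronglyMeasurable K (ae_of_all _ hK)
    obtain ⟨b, hb⟩ := exists_bounds_integral_mul (μ := χ) hσm hσmp (m := fun _ => 1) (M := h)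
      (integrable_const 1) hhi (fun _ => zero_le_one) (a := a) (δ := osc h)
      (fun x => by simpa using (ha x).1) (fun x => by simpa using (ha x).2)
    refine ⟨b, fun y => ?_⟩
    obtain ⟨hl, hu⟩ := hb (fun x => q x y) (hqy y) (fun x => hq x y)
    simp only [ell, ← mul_assoc, integral_mul_const, zero_add, pow_one]
    exact ⟨mul_le_mul_of_nonneg_right hl (hg0 _ y), mul_le_mul_of_nonneg_right hu (hg0 _ y)⟩
  | succ n ih =>
    obtain ⟨a, ha⟩ := ih
    have hkm := ell_measurable (ν := ν) hqm hgm s n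
    have hkb := ell_bounded (ν := ν) hqb hgb s n
    obtain ⟨b, hb⟩ := exists_bounds_integral_mul (μ := ν) hσm hσmp
      (integrable_integral_mul_kernel (μ := χ) measurable_const hkm h1b hkb)
      (integrable_integral_mul_kernel (μ := χ) hhm hkm hhb hkb)
      (fun y => integral_nonneg fun x =>
        mul_nonneg zero_le_one (ell_nonneg hq0 hg0 s n x y))
      (fun y => (ha y).1) (fun y => (ha y).2)
    refine ⟨b, fun y => ?_⟩
    obtain ⟨hl, hu⟩ := hb (fun x => q x y) (hqy y) (fun x => hq x y)
    have hφm : Measurable fun z => q z y * g (s + n + 2) y := (hqy y).mul_const _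
    have hφb : ∃ K, ∀ z, |q z y * g (s + n + 2) y| ≤ K :=
      ⟨σp * g (s + n + 2) y, fun z => by
        rw [abs_of_nonneg (mul_nonneg (hq0 _ _) (hg0 _ _))]
        exact mul_le_mul_of_nonneg_right (hq z y).2 (hg0 _ _)⟩
    simp only [ell]
    rw [integral_mul_integral_mul_comm hhm hkm hφm hhb hkb hφb,
      integral_mul_integral_mul_comm measurable_const hkm hφm h1b hkb hφb]
    simp only [← mul_assoc, integral_mul_const]
    refine ⟨mul_le_mul_of_nonneg_right hl (hg0 _ y), ?_⟩
    have := mul_le_mul_of_nonneg_right hu (hg0 (s + n + 2) y)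
    rwa [pow_succ' _ (n + 1), mul_assoc (1 - σm / σp)]

theorem stmt_5 {X : Type*} [MeasurableSpace X] (ν : Measure X) (hν : ν Set.univ = 1)
    (σm σp : ℝ) (hσm : 0 < σm) (hσmp : σm ≤ σp)
    (q : X → X → ℝ) (hqmeas : Measurable fun pr : X × X => q pr.1 pr.2)
    (hq : ∀ x y, σm ≤ q x y ∧ q x y ≤ σp)
    (g : ℕ → X → ℝ) (hgmeas : ∀ u, Measurable (g u))
    (hg0 : ∀ u x, 0 ≤ g u x) (hgb : ∀ u, ∃ K, ∀ x, g u x ≤ K)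
    (s t : ℕ) (hst : s < t)
    (χ : Measure X) [IsProbabilityMeasure χ]
    (h : X → ℝ) (hhm : Measurable h) (hhb : ∃ K, ∀ x, |h x| ≤ K)
    (f f' : X → ℝ) (hfm : Measurable f) (hf'm : Measurable f')
    (hf0 : ∀ x, 0 ≤ f x) (hf'0 : ∀ x, 0 ≤ f' x)
    (hfb : ∃ K, ∀ x, f x ≤ K) (hf'b : ∃ K, ∀ x, f' x ≤ K)
    (hpos : 0 < ∫ x, ∫ y, ellST ν q g s t x y * f y ∂ν ∂χ)
    (hpos' : 0 < ∫ x, ∫ y, ellST ν q g s t x y * f' y ∂ν ∂χ) :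
    |(∫ x, h x * ∫ y, ellST ν q g s t x y * f y ∂ν ∂χ) /
        (∫ x, ∫ y, ellST ν q g s t x y * f y ∂ν ∂χ) -
      (∫ x, h x * ∫ y, ellST ν q g s t x y * f' y ∂ν ∂χ) /
        (∫ x, ∫ y, ellST ν q g s t x y * f' y ∂ν ∂χ)| ≤
      (1 - σm / σp) ^ (t - s) * osc h := by
  have : IsProbabilityMeasure ν := ⟨hν⟩
  have : Nonempty X := nonempty_of_isProbabilityMeasure χ
  have abs_bounded : ∀ φ : X → ℝ, (∀ x, 0 ≤ φ x) → (∃ K, ∀ x, φ x ≤ K) →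
      ∃ K, ∀ x, |φ x| ≤ K := fun φ h0 ⟨K, hK⟩ => ⟨K, fun x => by
    rw [abs_of_nonneg (h0 x)]; exact hK x⟩
  have hqb : ∃ K, ∀ x y, |q x y| ≤ K := ⟨σp, fun x y => by
    rw [abs_of_nonneg (hσm.le.trans (hq x y).1)]; exact (hq x y).2⟩
  have hgb' := fun u => abs_bounded (g u) (hg0 u) (hgb u)
  have hlen : t - s - 1 + 1 = t - s := by omega
  have hkm := ell_measurable (ν := ν) hqmeas hgmeas s (t - s - 1)
  have hkb := ell_bounded (ν := ν) hqb hgb' s (t - s - 1)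
  have h1b : ∃ K : ℝ, ∀ _ : X, |(1 : ℝ)| ≤ K := ⟨1, fun _ => by simp⟩
  obtain ⟨a, ha⟩ := exists_bounds_integral_mul_ell (ν := ν) hσm hσmp hqmeas hq hgmeas hg0 hgb' s
    (t - s - 1) (χ := χ) hhm hhb
  rw [hlen] at ha
  have ratio_bounds : ∀ φ : X → ℝ, Measurable φ → (∀ x, 0 ≤ φ x) → (∃ K, ∀ x, φ x ≤ K) →
      0 < ∫ x, ∫ y, ellST ν q g s t x y * φ y ∂ν ∂χ →
      a ≤ (∫ x, h x * ∫ y, ellST ν q g s t x y * φ y ∂ν ∂χ) /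
        (∫ x, ∫ y, ellST ν q g s t x y * φ y ∂ν ∂χ) ∧
      (∫ x, h x * ∫ y, ellST ν q g s t x y * φ y ∂ν ∂χ) /
        (∫ x, ∫ y, ellST ν q g s t x y * φ y ∂ν ∂χ) ≤ a + (1 - σm / σp) ^ (t - s) * osc h := by
    intro φ hφm hφ0 hφb hφpos
    obtain ⟨K, hK⟩ := abs_bounded φ hφ0 hφb
    have int_mul : ∀ {F : X → ℝ}, Integrable F ν → Integrable (fun y => F y * φ y) ν := fun hF =>
      hF.mul_bdd hφm.aestronglyMeasurable (ae_of_all _ hK)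
    have hden := integral_mul_integral_mul_comm (μ := χ) (ν := ν) measurable_const hkm hφm h1b hkb
      ⟨K, hK⟩
    have hnum := integral_mul_integral_mul_comm (μ := χ) (ν := ν) hhm hkm hφm hhb hkb ⟨K, hK⟩
    have hi1 := int_mul
      (integrable_integral_mul_kernel (μ := χ) (ν := ν) measurable_const hkm h1b hkb)
    have hih := int_mul (integrable_integral_mul_kernel (μ := χ) (ν := ν) hhm hkm hhb hkb)
    simp only [one_mul] at hden hi1 ha
    rw [le_div_iff₀ hφpos, div_le_iff₀ hφpos]
    simp only [ellST]
    rw [hden, hnum, ← integral_const_mul, ← integral_const_mul]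
    constructor
    · refine integral_mono (hi1.const_mul _) hih fun y => ?_
      simpa only [mul_assoc] using mul_le_mul_of_nonneg_right (ha y).1 (hφ0 y)
    · refine integral_mono hih (hi1.const_mul _) fun y => ?_
      simpa only [mul_assoc] using mul_le_mul_of_nonneg_right (ha y).2 (hφ0 y)
  obtain ⟨hl, hu⟩ := ratio_bounds f hfm hf0 hfb hpos
  obtain ⟨hl', hu'⟩ := ratio_bounds f' hf'm hf'0 hf'b hpos'
  rw [abs_le]
  constructor <;> linarith
end

section
/- Fix an integer N ≥ 1, integers s < t, and constants 0 < σ₋ ≤ σ₊ < ∞; set ρ = 1 − σ₋/σ₊. For each u ∈ {s+1, …, t} let ω_{u−1} : {1,…,N} → (0,∞) be positive weights and let q_u : {1,…,N} × {1,…,N} → ℝ satisfy σ₋ ≤ q_u(j,i) ≤ σ₊ for all i, j. Define the N × N stochastic matrices W_u by W_u^{i,j} = ω_{u−1}(j)·q_u(j,i) / Σ_{ℓ=1}^N ω_{u−1}(ℓ)·q_u(ℓ,i). Then for any two probability vectors μ, μ' on {1,…,N} and any function h : {1,…,N} → ℝ, | Σ_{i_s,…,i_t = 1}^N h(i_s)·(∏_{u=s+1}^{t}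 W_u^{i_u, i_{u−1}})·(μ(i_t) − μ'(i_t)) | ≤ osc(h)·ρ^{t−s}, where osc(h) = max_{i,j} |h(i) − h(j)|. -/
/-- The backward-kernel stochastic matrix:
`Wmat w qm i j = w j * qm j i / ∑ ℓ, w ℓ * qm ℓ i`. -/
noncomputable def Wmat {N : ℕ} (w : Fin N → ℝ) (qm : Fin N → Fin N → ℝ)
    (i j : Fin N) : ℝ :=
  w j * qm j i / ∑ ℓ, w ℓ * qm ℓ i

/-- Two nonnegative weight vectors of equal total mass `c` integrate `h` to values at distance at
most `c * D`, where `D` bounds the oscillation of `h`. -/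
lemma abs_sum_mul_sub_sum_mul_le {ι : Type*} [Fintype ι] [Nonempty ι] {a b h : ι → ℝ} {c D : ℝ}
    (ha : ∀ i, 0 ≤ a i) (hb : ∀ i, 0 ≤ b i) (hac : ∑ i, a i = c) (hbc : ∑ i, b i = c)
    (hD : ∀ i j, h i - h j ≤ D) :
    |∑ i, a i * h i - ∑ i, b i * h i| ≤ c * D := by
  obtain ⟨iM, hM⟩ := Finite.exists_max h
  obtain ⟨im, hm⟩ := Finite.exists_min h
  have hc : 0 ≤ c := hac ▸ Finset.sum_nonneg fun i _ => ha i
  have upper : ∀ v : ι → ℝ, (∀ i, 0 ≤ v i) → ∑ i, v i = c → ∑ i, v i * h i ≤ c * h iM := by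
    intro v hv hvc
    rw [← hvc, Finset.sum_mul]
    exact Finset.sum_le_sum fun i _ => mul_le_mul_of_nonneg_left (hM i) (hv i)
  have lower : ∀ v : ι → ℝ, (∀ i, 0 ≤ v i) → ∑ i, v i = c → c * h im ≤ ∑ i, v i * h i := by
    intro v hv hvc
    rw [← hvc, Finset.sum_mul]
    exact Finset.sum_le_sum fun i _ => mul_le_mul_of_nonneg_left (hm i) (hv i)
  have hcD : c * h iM - c * h im ≤ c * D := by
    rw [← mul_sub]
    exact mul_le_mul_of_nonneg_left (hD iM im) hc
  rw [abs_le]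
  constructor
  · linarith [upper b hb hbc, lower a ha hac]
  · linarith [upper a ha hac, lower b hb hbc]

/-- A stochastic matrix satisfying a Doeblin minorization with constant `ε` contracts oscillations
by the factor `1 - ε`. -/
lemma sum_mul_sub_sum_mul_le_of_doeblin {ι : Type*} [Fintype ι] [Nonempty ι]
    {P : ι → ι → ℝ} {ν h : ι → ℝ} {ε D : ℝ} (hP : ∀ i, ∑ j, P i j = 1) (hν : ∑ j, ν j = 1)
    (hPν : ∀ i j, ε * ν j ≤ P i j) (hD : ∀ i j, h i - h j ≤ D) (i i' : ι) :
    ∑ j, P i j * h j - ∑ j, P i' j * h j ≤ D * (1 - ε) := by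
  have mass : ∀ i, ∑ j, (P i j - ε * ν j) = 1 - ε := fun i => by
    rw [Finset.sum_sub_distrib, ← Finset.mul_sum, hP, hν, mul_one]
  have key := (abs_le.1 (abs_sum_mul_sub_sum_mul_le (fun j => sub_nonneg.2 (hPν i j))
    (fun j => sub_nonneg.2 (hPν i' j)) (mass i) (mass i') hD)).2
  simp only [sub_mul, Finset.sum_sub_distrib] at key
  linarith

/-- Geometric forgetting of the terminal law for an inhomogeneous chain, run backwards from time
`m` to time `0`, whose transition matrices satisfy a Doeblin minorization. -/
lemma abs_sum_path_le_of_doeblin {ι : Type*} [Fintype ι] [Nonempty ι] {μ μ' : ι → ℝ} {ε : ℝ}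
    (hμ0 : ∀ i, 0 ≤ μ i) (hμ1 : ∑ i, μ i = 1) (hμ'0 : ∀ i, 0 ≤ μ' i) (hμ'1 : ∑ i, μ' i = 1)
    (m : ℕ) (P : Fin m → ι → ι → ℝ) (ν : Fin m → ι → ℝ) (hP : ∀ k i, ∑ j, P k i j = 1)
    (hν : ∀ k, ∑ j, ν k j = 1) (hPν : ∀ k i j, ε * ν k j ≤ P k i j)
    (h : ι → ℝ) (D : ℝ) (hD : ∀ i j, h i - h j ≤ D) :
    |∑ path : Fin (m + 1) → ι, h (path 0) * (∏ k, P k (path k.succ) (path k.castSucc)) *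
        (μ (path (Fin.last m)) - μ' (path (Fin.last m)))| ≤ D * (1 - ε) ^ m := by
  induction m generalizing h D with
  | zero =>
    rw [← (Equiv.funUnique (Fin 1) ι).symm.sum_comp]
    have key := abs_sum_mul_sub_sum_mul_le hμ0 hμ'0 hμ1 hμ'1 hD
    rw [← Finset.sum_sub_distrib] at key
    simpa [mul_sub, mul_comm] using key
  | succ m ih =>
    have key := ih (fun k => P k.succ) (fun k => ν k.succ) (fun k => hP k.succ)
      (fun k => hν k.succ) (fun k => hPν k.succ) (fun i => ∑ j, P 0 i j * h j) (D * (1 - ε))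
      (sum_mul_sub_sum_mul_le_of_doeblin (hP 0) (hν 0) (hPν 0) hD)
    rw [mul_assoc, ← pow_succ'] at key
    convert key using 2
    rw [← (Fin.consEquiv fun _ => ι).sum_comp, Fintype.sum_prod_type_right]
    refine Finset.sum_congr rfl fun path _ => ?_
    rw [Finset.sum_mul, Finset.sum_mul]
    refine Finset.sum_congr rfl fun j _ => ?_
    rw [Fin.prod_univ_succ]
    simp only [Fin.consEquiv_apply, Fin.cons_zero, Fin.cons_succ, Fin.castSucc_zero,
      ← Fin.succ_castSucc, ← Fin.succ_last]
    ring

lemma sum_Wmat {N : ℕ} {w : Fin N → ℝ} {q : Fin N → Fin N → ℝ} {i : Fin N}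
    (hpos : 0 < ∑ l, w l * q l i) : ∑ j, Wmat w q i j = 1 := by
  simp only [Wmat]
  rw [← Finset.sum_div, div_self hpos.ne']

/-- The backward kernel dominates `a / b` times the normalized weights. -/
lemma mul_div_sum_le_Wmat {N : ℕ} {w : Fin N → ℝ} {q : Fin N → Fin N → ℝ} {a b : ℝ}
    (ha : 0 < a) (hw : ∀ i, 0 < w i) (hq : ∀ i j, a ≤ q j i ∧ q j i ≤ b) (i j : Fin N) :
    a / b * (w j / ∑ l, w l) ≤ Wmat w q i j := by
  have hqpos : ∀ l, 0 < q l i := fun l => ha.trans_le (hq i l).1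
  have hpos : 0 < ∑ l, w l * q l i :=
    Finset.sum_pos (fun l _ => mul_pos (hw l) (hqpos l)) ⟨j, Finset.mem_univ j⟩
  have hle : ∑ l, w l * q l i ≤ b * ∑ l, w l := by
    rw [Finset.mul_sum]
    refine Finset.sum_le_sum fun l _ => ?_
    rw [mul_comm b]
    exact mul_le_mul_of_nonneg_left (hq i l).2 (hw l).le
  rw [div_mul_div_comm, Wmat, mul_comm a]
  exact div_le_div₀ (mul_pos (hw j) (hqpos j)).le
    (mul_le_mul_of_nonneg_left (hq i j).1 (hw j).le) hpos hle

lemma sub_le_osc {X : Type*} [Finite X] (h : X → ℝ) (i j : X) : h i - h j ≤ osc h :=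
  (le_abs_self _).trans
    (le_ciSup (f := fun pr : X × X => |h pr.1 - h pr.2|) (Set.finite_range _).bddAbove (i, j))

theorem stmt_8 (N : ℕ) (hN : 1 ≤ N) (s m : ℕ) (hm : 1 ≤ m)
    (σm σp : ℝ) (hσm : 0 < σm) (hσmp : σm ≤ σp)
    (w : ℕ → Fin N → ℝ) (hw : ∀ u ∈ Finset.Icc (s + 1) (s + m), ∀ i, 0 < w u i)
    (qm : ℕ → Fin N → Fin N → ℝ)
    (hq : ∀ u ∈ Finset.Icc (s + 1) (s + m), ∀ i j, σm ≤ qm u j i ∧ qm u j i ≤ σp)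
    (μ μ' : Fin N → ℝ)
    (hμ0 : ∀ i, 0 ≤ μ i) (hμ1 : ∑ i, μ i = 1)
    (hμ'0 : ∀ i, 0 ≤ μ' i) (hμ'1 : ∑ i, μ' i = 1)
    (h : Fin N → ℝ) :
    |∑ path : Fin (m + 1) → Fin N,
        h (path 0) *
          (∏ k : Fin m, Wmat (w (s + 1 + (k : ℕ))) (qm (s + 1 + (k : ℕ)))
            (path k.succ) (path k.castSucc)) *
          (μ (path (Fin.last m)) - μ' (path (Fin.last m)))| ≤
      osc h * (1 - σm / σp) ^ m := by
  have : NeZero N := ⟨by omega⟩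
  have mem : ∀ k : Fin m, s + 1 + (k : ℕ) ∈ Finset.Icc (s + 1) (s + m) := fun k => by
    rw [Finset.mem_Icc]
    omega
  refine abs_sum_path_le_of_doeblin hμ0 hμ1 hμ'0 hμ'1 m
    (fun k => Wmat (w (s + 1 + (k : ℕ))) (qm (s + 1 + (k : ℕ))))
    (fun k j => w (s + 1 + (k : ℕ)) j / ∑ l, w (s + 1 + (k : ℕ)) l)
    (fun k i => sum_Wmat ?_) (fun k => ?_)
    (fun k => mul_div_sum_le_Wmat hσm (hw _ (mem k)) (hq _ (mem k))) h _ (sub_le_osc h)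
  · exact Finset.sum_pos (fun l _ => mul_pos (hw _ (mem k) l)
      (hσm.trans_le (hq _ (mem k) i l).1)) Finset.univ_nonempty
  · rw [← Finset.sum_div]
    exact div_self (Finset.sum_pos (fun l _ => hw _ (mem k) l) Finset.univ_nonempty).ne'
end
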